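/- Let T ≥ 3 and set P = exp(√(log T)). Then (1/T) ∫_T^{2T} (Re ∑_{p ≤ P, p prime} p^{-1/2-it})² dt = (1/4)·log log T + O(1), with an absolute implied constant. -/

import Mathlib

open Complex MeasureTheory

/-- The finite set of primes `p ≤ y`. -/
noncomputable def primesUpTo (y : ℝ) : Finset ℕ :=
  (Finset.range (⌊y⌋₊ + 1)).filter fun p => p.Prime ∧ (p : ℝ) ≤ y

open Finset in
/-- The factorization of `n !`, taken logarithmically. -/
theorem log_factorial_eq_sum_primes (n : ℕ) :
    Real.log n.factorial =
      ∑ p ∈ range (n + 1) with p.Prime, (n.factorial.factorization p : ℝ) * Real.log p := by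
  have hsub : n.factorial.factorization.support ⊆ {p ∈ range (n + 1) | p.Prime} := by
    intro p hp
    rw [Nat.support_factorization, Nat.mem_primeFactors] at hp
    have := (hp.1.dvd_factorial).1 hp.2.1
    simp only [mem_filter, mem_range]
    exact ⟨by omega, hp.1⟩
  conv_lhs => rw [← Nat.prod_factorization_pow_eq_self n.factorial_ne_zero]
  rw [Finsupp.prod_of_support_subset _ hsub _ (fun _ _ => pow_zero _), Nat.cast_prod,
    Real.log_prod]
  · exact sum_congr rfl fun p _ => by rw [Nat.cast_pow, Real.log_pow]
  · intro p hp
    have := (mem_filter.1 hp).2.pos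
    positivity

/-- Legendre's lower bound for the exponent of `p` in `n !`. -/
theorem div_sub_one_le_factorization_factorial {p n : ℕ} (hp : p.Prime) (hpn : p ≤ n) :
    (n : ℝ) / p - 1 ≤ n.factorial.factorization p := by
  have hlog : 1 ≤ Nat.log p n := Nat.log_pos hp.one_lt hpn
  have hle : n / p ≤ n.factorial.factorization p := by
    rw [Nat.factorization_factorial hp (Nat.lt_succ_self _)]
    have := Finset.single_le_sum (f := fun i => n / p ^ i) (fun i _ => Nat.zero_le _)
      (Finset.mem_Ico.2 ⟨le_rfl, by omega⟩ : 1 ∈ Finset.Ico 1 (Nat.log p n).succ)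
    simpa using this
  have h1 : (n : ℝ) / p < (n / p : ℕ) + 1 := by
    rw [← Nat.floor_div_eq_div (K := ℝ)]
    exact Nat.lt_floor_add_one _
  have h2 : ((n / p : ℕ) : ℝ) ≤ n.factorial.factorization p := by exact_mod_cast hle
  linarith

/-- Legendre's upper bound for the exponent of `p` in `n !`. -/
theorem factorization_factorial_le_div_add {p n : ℕ} (hp : p.Prime) :
    (n.factorial.factorization p : ℝ) ≤ n / p + n / (p * (p - 1)) := by
  have h2 : (2 : ℝ) ≤ p := by exact_mod_cast hp.two_le
  have h1 : (n.factorial.factorization p : ℝ) ≤ (n : ℝ) / ((p - 1 : ℕ) : ℝ) :=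
    (Nat.cast_le.2 (Nat.factorization_factorial_le_div_pred hp n)).trans Nat.cast_div_le
  rw [Nat.cast_sub hp.one_le, Nat.cast_one] at h1
  refine h1.trans_eq ?_
  have : (p : ℝ) - 1 ≠ 0 := by linarith
  field_simp
  ring

theorem log_div_mul_sub_one_nonneg (n : ℕ) : 0 ≤ Real.log n / (n * (n - 1) : ℝ) := by
  rcases n with _ | n
  · simp
  · have := Real.log_natCast_nonneg (n + 1)
    push_cast at this ⊢
    rw [add_sub_cancel_right]
    positivity

theorem summable_log_div_mul_sub_one :
    Summable fun n : ℕ => Real.log n / (n * (n - 1) : ℝ) := by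
  have hs : Summable fun n : ℕ => 4 * (n : ℝ) ^ (-(3 / 2) : ℝ) :=
    (Real.summable_nat_rpow.2 (by norm_num)).mul_left 4
  refine Summable.of_nonneg_of_le log_div_mul_sub_one_nonneg (fun n => ?_) hs
  rcases lt_or_ge n 2 with h | h
  · interval_cases n
    · simp
    · simp
  · have h2 : (2 : ℝ) ≤ n := by exact_mod_cast h
    have hlog := Real.log_natCast_le_rpow_div n (show (0 : ℝ) < 1 / 2 by norm_num)
    have hsplit : (n : ℝ) ^ (1 / 2 : ℝ) = (n : ℝ) ^ (-(3 / 2) : ℝ) * n ^ 2 := by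
      rw [← Real.rpow_natCast, ← Real.rpow_add (by linarith)]
      norm_num
    have hpos : 0 < (n : ℝ) ^ (-(3 / 2) : ℝ) := Real.rpow_pos_of_pos (by linarith) _
    rw [div_le_iff₀ (by nlinarith)]
    rw [hsplit] at hlog
    have : (n : ℝ) ^ 2 ≤ 2 * (n * (n - 1)) := by nlinarith
    nlinarith [mul_le_mul_of_nonneg_left this hpos.le]

open Finset in
/-- **Mertens' first theorem**: `∑ p ≤ n, log p / p = log n + O(1)`. -/
theorem exists_abs_sum_log_div_sub_log_le :
    ∃ C : ℝ, 0 ≤ C ∧ ∀ n : ℕ, 1 ≤ n →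
      |∑ p ∈ range (n + 1) with p.Prime, Real.log p / p - Real.log n| ≤ C := by
  set K : ℝ := ∑' n : ℕ, Real.log n / (n * (n - 1) : ℝ)
  have hK : 0 ≤ K := tsum_nonneg log_div_mul_sub_one_nonneg
  have hlog4 : 0 ≤ Real.log 4 := Real.log_nonneg (by norm_num)
  refine ⟨K + 1 + Real.log 4, by positivity, fun n hn => ?_⟩
  have hn0 : (0 : ℝ) < n := by exact_mod_cast hn
  set M : ℝ := ∑ p ∈ range (n + 1) with p.Prime, Real.log p / p with hM
  have hupper : Real.log n.factorial ≤ n * M + n * K := by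
    have hsum : ∑ p ∈ range (n + 1) with p.Prime, Real.log p / (p * (p - 1) : ℝ) ≤ K :=
      summable_log_div_mul_sub_one.sum_le_tsum _ fun i _ => log_div_mul_sub_one_nonneg i
    calc Real.log n.factorial
        ≤ ∑ p ∈ range (n + 1) with p.Prime,
            (n * (Real.log p / p) + n * (Real.log p / (p * (p - 1) : ℝ))) := by
          rw [log_factorial_eq_sum_primes]
          refine sum_le_sum fun p hp => ?_
          refine (mul_le_mul_of_nonneg_right
            (factorization_factorial_le_div_add (mem_filter.1 hp).2)
            (Real.log_natCast_nonneg p)).trans_eq ?_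
          ring
      _ = n * M + n * ∑ p ∈ range (n + 1) with p.Prime, Real.log p / (p * (p - 1) : ℝ) := by
          rw [sum_add_distrib, ← mul_sum, ← mul_sum]
      _ ≤ n * M + n * K := by gcongr
  have hlower : n * M - Real.log 4 * n ≤ Real.log n.factorial := by
    have htheta : ∑ p ∈ range (n + 1) with p.Prime, Real.log p ≤ Real.log 4 * n := by
      have := Chebyshev.theta_le_log4_mul_x hn0.le
      rwa [Chebyshev.theta_eq_sum_Icc, Nat.floor_natCast, ← Nat.range_succ_eq_Icc_zero] at this
    calc n * M - Real.log 4 * n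
        ≤ n * M - ∑ p ∈ range (n + 1) with p.Prime, Real.log p := by gcongr
      _ = ∑ p ∈ range (n + 1) with p.Prime, ((n : ℝ) / p - 1) * Real.log p := by
          rw [hM, mul_sum, ← sum_sub_distrib]
          exact sum_congr rfl fun p _ => by ring
      _ ≤ Real.log n.factorial := by
          rw [log_factorial_eq_sum_primes]
          refine sum_le_sum fun p hp => ?_
          rw [mem_filter, mem_range] at hp
          exact mul_le_mul_of_nonneg_right
            (div_sub_one_le_factorization_factorial hp.2 (by omega)) (Real.log_natCast_nonneg p)
  have hstir_le : Real.log n.factorial ≤ n * Real.log n := by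
    rw [← Real.log_pow]
    exact Real.log_le_log (by exact_mod_cast n.factorial_pos)
      (by exact_mod_cast n.factorial_le_pow)
  have hstir_ge : n * Real.log n - n ≤ Real.log n.factorial := by
    have hf : (0 : ℝ) < n.factorial := by exact_mod_cast n.factorial_pos
    have := Real.log_le_log (by positivity) (Real.pow_div_factorial_le_exp n hn0.le n)
    rw [Real.log_exp, Real.log_div (by positivity) hf.ne', Real.log_pow] at this
    linarith
  rw [abs_le]
  constructor
  · refine le_of_mul_le_mul_left ?_ hn0
    nlinarith
  · refine le_of_mul_le_mul_left ?_ hn0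
    nlinarith

theorem abs_sub_div_sub_log_sub_log_le {u v : ℝ} (hu : 0 < u) (huv : u ≤ v) :
    |(v - u) / v - (Real.log v - Real.log u)| ≤ (v - u) * (1 / u - 1 / v) := by
  have hv : 0 < v := hu.trans_le huv
  have h1 := Real.one_sub_inv_le_log_of_pos (div_pos hv hu)
  have h2 := Real.log_le_sub_one_of_pos (div_pos hv hu)
  rw [Real.log_div hv.ne' hu.ne'] at h1 h2
  rw [inv_div] at h1
  have e1 : (v - u) / v = 1 - u / v := by field_simp
  have e2 : (v - u) * (1 / u - 1 / v) = v / u - 1 - (1 - u / v) := by field_simp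
  rw [e2, e1, abs_le]
  constructor <;> linarith

open Finset in
/-- **Mertens' second theorem** at the integers: `∑ p ≤ n, 1 / p = log log n + O(1)`. -/
theorem exists_abs_sum_one_div_sub_log_log_natCast_le :
    ∃ C : ℝ, 0 ≤ C ∧ ∀ n : ℕ, 2 ≤ n →
      |∑ p ∈ range (n + 1) with p.Prime, 1 / (p : ℝ) - Real.log (Real.log n)| ≤ C := by
  obtain ⟨C, hC0, hC⟩ := exists_abs_sum_log_div_sub_log_le
  set S : ℕ → ℝ := fun n => ∑ p ∈ range (n + 1) with p.Prime, 1 / (p : ℝ) with hS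
  set M : ℕ → ℝ := fun n => ∑ p ∈ range (n + 1) with p.Prime, Real.log p / (p : ℝ) with hM
  set D : ℕ → ℝ := fun n =>
    S n - Real.log (Real.log n) - (M n - Real.log n) / Real.log n with hD
  have hlog2 : 0 < Real.log 2 := Real.log_pos (by norm_num)
  have hlogn : ∀ n : ℕ, 2 ≤ n → Real.log 2 ≤ Real.log n := fun n hn =>
    Real.log_le_log (by norm_num) (by exact_mod_cast hn)
  have hDbound : ∀ n : ℕ, 2 ≤ n →
      |D n - D 2| ≤ (1 + C) * (1 / Real.log 2 - 1 / Real.log n) := by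
    intro n hn
    induction n, hn using Nat.le_induction with
    | base => simp
    | succ n hn ih =>
      set u := Real.log n with hu
      set v := Real.log ((n + 1 : ℕ) : ℝ) with hv
      have hu0 : 0 < u := hlog2.trans_le (hlogn n hn)
      have hn0 : (2 : ℝ) ≤ n := by exact_mod_cast hn
      have huv : u ≤ v := Real.log_le_log (by linarith) (by push_cast; linarith)
      have hv0 : 0 < v := hu0.trans_le huv
      have hvu : v - u ≤ 1 := by
        have := Real.log_le_sub_one_of_pos (show 0 < ((n + 1 : ℕ) : ℝ) / n by positivity)
        rw [Real.log_div (by positivity) (by positivity)] at this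
        have h' : ((n + 1 : ℕ) : ℝ) / n ≤ 2 := by
          rw [div_le_iff₀ (by positivity)]
          push_cast
          linarith
        linarith
      have hinv : 0 ≤ 1 / u - 1 / v := sub_nonneg.2 (one_div_le_one_div_of_le hu0 huv)
      have hstep : (S (n + 1) - S n) * v = M (n + 1) - M n := by
        simp only [hS, hM]
        rw [range_add_one (n := n + 1), filter_insert]
        split_ifs with hp
        · rw [sum_insert (by simp), sum_insert (by simp)]
          ring
        · simp
      have hdiff : D (n + 1) - D n =
          ((v - u) / v - (Real.log v - Real.log u)) + (M n - u) * (1 / u - 1 / v) := by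
        have hS' : S (n + 1) = S n + (M (n + 1) - M n) / v := by
          rw [← hstep]
          field_simp
          ring
        simp only [hD, hS', ← hu, ← hv]
        field_simp
        ring
      have h1 := abs_sub_div_sub_log_sub_log_le hu0 huv
      have h2 : |(M n - u) * (1 / u - 1 / v)| ≤ C * (1 / u - 1 / v) := by
        rw [abs_mul, abs_of_nonneg hinv]
        exact mul_le_mul_of_nonneg_right (hC n (by omega)) hinv
      have h3 : (v - u) * (1 / u - 1 / v) ≤ 1 * (1 / u - 1 / v) :=
        mul_le_mul_of_nonneg_right hvu hinv
      calc |D (n + 1) - D 2| = |(D (n + 1) - D n) + (D n - D 2)| := by ring_nf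
        _ ≤ |D (n + 1) - D n| + |D n - D 2| := abs_add_le _ _
        _ ≤ (1 + C) * (1 / u - 1 / v) + (1 + C) * (1 / Real.log 2 - 1 / u) := by
          refine add_le_add ?_ ih
          rw [hdiff]
          refine (abs_add_le _ _).trans ?_
          linarith
        _ = (1 + C) * (1 / Real.log 2 - 1 / v) := by ring
  refine ⟨(1 + C) / Real.log 2 + |D 2| + C / Real.log 2, by positivity, fun n hn => ?_⟩
  have hu := hlogn n hn
  have hu0 : 0 < Real.log n := hlog2.trans_le hu
  have h1 : |D n - D 2| ≤ (1 + C) / Real.log 2 := by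
    refine (hDbound n hn).trans ?_
    rw [div_eq_mul_one_div (1 + C)]
    have : 0 ≤ 1 / Real.log n := by positivity
    gcongr
    linarith
  have h2 : |(M n - Real.log n) / Real.log n| ≤ C / Real.log 2 := by
    rw [abs_div, abs_of_pos hu0]
    exact div_le_div₀ hC0 (hC n (by omega)) hlog2 hu
  calc |S n - Real.log (Real.log n)|
      = |(D n - D 2) + D 2 + (M n - Real.log n) / Real.log n| := by
        simp only [hD]
        ring_nf
    _ ≤ |D n - D 2| + |D 2| + |(M n - Real.log n) / Real.log n| := abs_add_three _ _ _
    _ ≤ _ := by gcongr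

theorem mem_primesUpTo {y : ℝ} {p : ℕ} (hp : p ∈ primesUpTo y) : p.Prime ∧ (p : ℝ) ≤ y :=
  (Finset.mem_filter.1 hp).2

theorem primesUpTo_eq_filter_range {y : ℝ} (hy : 0 ≤ y) :
    primesUpTo y = {p ∈ Finset.range (⌊y⌋₊ + 1) | p.Prime} := by
  refine Finset.filter_congr fun p hp => and_iff_left ?_
  rw [Finset.mem_range, Nat.lt_succ_iff] at hp
  exact (Nat.le_floor_iff hy).1 hp

theorem card_primesUpTo_le {y : ℝ} (hy : 0 ≤ y) : ((primesUpTo y).card : ℝ) ≤ y := by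
  have hsub : primesUpTo y ⊆ Finset.Icc 1 ⌊y⌋₊ := fun p hp => by
    obtain ⟨hp1, hp2⟩ := mem_primesUpTo hp
    exact Finset.mem_Icc.2 ⟨hp1.one_le, Nat.le_floor hp2⟩
  have hcard := Finset.card_le_card hsub
  rw [Nat.card_Icc, Nat.add_sub_cancel] at hcard
  exact (Nat.cast_le.2 hcard).trans (Nat.floor_le hy)

/-- **Mertens' second theorem**: `∑ p ≤ y, 1 / p = log log y + O(1)`. -/
theorem exists_abs_sum_one_div_sub_log_log_le :
    ∃ C : ℝ, 0 ≤ C ∧ ∀ y : ℝ, 2 ≤ y →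
      |∑ p ∈ primesUpTo y, 1 / (p : ℝ) - Real.log (Real.log y)| ≤ C := by
  obtain ⟨C, hC0, hC⟩ := exists_abs_sum_one_div_sub_log_log_natCast_le
  have hlog2 : 0 < Real.log 2 := Real.log_pos (by norm_num)
  refine ⟨C + Real.log 2, by positivity, fun y hy => ?_⟩
  rw [primesUpTo_eq_filter_range (by linarith)]
  have hn : 2 ≤ ⌊y⌋₊ := Nat.le_floor (by exact_mod_cast hy)
  have hmain := hC _ hn
  have hny : (⌊y⌋₊ : ℝ) ≤ y := Nat.floor_le (by linarith)
  have hyn : y < ⌊y⌋₊ + 1 := Nat.lt_floor_add_one y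
  set n := ⌊y⌋₊
  have hn2 : (2 : ℝ) ≤ n := by exact_mod_cast hn
  have hlogn : Real.log 2 ≤ Real.log n := Real.log_le_log (by norm_num) hn2
  have hle : Real.log n ≤ Real.log y := Real.log_le_log (by linarith) hny
  have hle2 : Real.log y ≤ 2 * Real.log n := by
    have := Real.log_le_log (by linarith) (show y ≤ n * n by nlinarith)
    rw [Real.log_mul (by linarith) (by linarith)] at this
    linarith
  have h1 : Real.log (Real.log n) ≤ Real.log (Real.log y) := Real.log_le_log (by linarith) hle
  have h2 : Real.log (Real.log y) ≤ Real.log 2 + Real.log (Real.log n) := by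
    rw [← Real.log_mul (by norm_num) (by linarith)]
    exact Real.log_le_log (by linarith) hle2
  rw [abs_le] at hmain ⊢
  constructor <;> linarith [hmain.1, hmain.2]

theorem abs_integral_cos_mul_le {a : ℝ} (ha : a ≠ 0) (x y : ℝ) :
    |∫ t in x..y, Real.cos (a * t)| ≤ 2 / |a| := by
  rw [intervalIntegral.integral_comp_mul_left _ ha, integral_cos, smul_eq_mul, abs_mul, abs_inv,
    div_eq_inv_mul]
  gcongr
  have := abs_le.1 (Real.abs_sin_le_one (a * y))
  have := abs_le.1 (Real.abs_sin_le_one (a * x))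
  rw [abs_le]
  constructor <;> linarith

theorem one_div_le_abs_log_sub_log {m n : ℕ} {y : ℝ} (hm : 0 < m) (hn : 0 < n) (hmn : m ≠ n)
    (hmy : (m : ℝ) ≤ y) (hny : (n : ℝ) ≤ y) : 1 / y ≤ |Real.log m - Real.log n| := by
  wlog h : n < m generalizing m n
  · rw [abs_sub_comm]
    exact this hn hm hmn.symm hny hmy (by omega)
  have hm0 : (0 : ℝ) < m := by exact_mod_cast hm
  have hn0 : (0 : ℝ) < n := by exact_mod_cast hn
  have hsucc : (n : ℝ) + 1 ≤ m := by exact_mod_cast h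
  have hlog := Real.one_sub_inv_le_log_of_pos (div_pos hm0 hn0)
  rw [Real.log_div hm0.ne' hn0.ne', inv_div] at hlog
  calc 1 / y ≤ 1 / m := one_div_le_one_div_of_le hm0 hmy
    _ ≤ 1 - n / m := by
      rw [le_sub_iff_add_le, ← add_div, div_le_one hm0]
      linarith
    _ ≤ Real.log m - Real.log n := hlog
    _ ≤ _ := le_abs_self _

theorem re_natCast_cpow_neg_half_sub {n : ℕ} (hn : 0 < n) (t : ℝ) :
    ((n : ℂ) ^ (-(1 / 2 : ℂ) - t * Complex.I)).re
      = (n : ℝ) ^ (-(1 / 2) : ℝ) * Real.cos (Real.log n * t) := by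
  have hn0 : (0 : ℝ) < n := by exact_mod_cast hn
  rw [Complex.cpow_def_of_ne_zero (by exact_mod_cast hn.ne'), Complex.exp_re,
    Real.rpow_def_of_pos hn0]
  simp [-Complex.natCast_log, Complex.log_re, Complex.log_im]

/-- Approximate orthogonality of the functions `t ↦ cos (t log p)` on `[T, 2T]`. -/
theorem abs_integral_cos_log_mul_cos_log_sub_le {p q : ℕ} {y T : ℝ} (hp : p.Prime) (hq : q.Prime)
    (hpy : (p : ℝ) ≤ y) (hqy : (q : ℝ) ≤ y) :
    |(∫ t in T..(2 * T), Real.cos (Real.log p * t) * Real.cos (Real.log q * t))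
      - (if p = q then T / 2 else 0)| ≤ 2 * y := by
  have hp2 : (2 : ℝ) ≤ p := by exact_mod_cast hp.two_le
  have hq2 : (2 : ℝ) ≤ q := by exact_mod_cast hq.two_le
  have hy : 0 < y := by linarith
  have hbound : ∀ a : ℝ, 1 / y ≤ |a| → |∫ t in T..(2 * T), Real.cos (a * t)| ≤ 2 * y := by
    intro a ha
    have hpos : 0 < |a| := lt_of_lt_of_le (by positivity) ha
    refine (abs_integral_cos_mul_le (abs_pos.1 hpos) _ _).trans ?_
    rw [div_le_iff₀ hpos]
    rw [div_le_iff₀ hy] at ha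
    linarith
  have hsum : |∫ t in T..(2 * T), Real.cos ((Real.log p + Real.log q) * t)| ≤ 2 * y := by
    refine hbound _ ?_
    have hlp := Real.log_two_gt_d9.trans_le (Real.log_le_log (by norm_num) hp2)
    have hlq := Real.log_two_gt_d9.trans_le (Real.log_le_log (by norm_num) hq2)
    have : 1 / y ≤ 1 := by
      rw [div_le_one hy]
      linarith
    refine le_trans ?_ (le_abs_self _)
    norm_num at hlp hlq
    linarith
  have hsub : |(∫ t in T..(2 * T), Real.cos ((Real.log p - Real.log q) * t))
      - (if p = q then T else 0)| ≤ 2 * y := by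
    split_ifs with h
    · subst h
      simp only [sub_self, zero_mul, Real.cos_zero, intervalIntegral.integral_const, smul_eq_mul,
        mul_one]
      rw [show 2 * T - T - T = 0 by ring, abs_zero]
      positivity
    · rw [sub_zero]
      exact hbound _ (one_div_le_abs_log_sub_log hp.pos hq.pos h hpy hqy)
  have hsplit : (∫ t in T..(2 * T), Real.cos (Real.log p * t) * Real.cos (Real.log q * t))
      = 1 / 2 * (∫ t in T..(2 * T), Real.cos ((Real.log p - Real.log q) * t))
        + 1 / 2 * ∫ t in T..(2 * T), Real.cos ((Real.log p + Real.log q) * t) := by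
    rw [← intervalIntegral.integral_const_mul, ← intervalIntegral.integral_const_mul,
      ← intervalIntegral.integral_add]
    · refine intervalIntegral.integral_congr fun t _ => ?_
      simp only [sub_mul, add_mul, Real.cos_sub, Real.cos_add]
      ring
    · exact (by fun_prop : Continuous _).intervalIntegrable _ _
    · exact (by fun_prop : Continuous _).intervalIntegrable _ _
  have hite : (if p = q then T / 2 else 0) = 1 / 2 * (if p = q then T else 0) := by
    split_ifs <;> ring
  rw [hsplit, hite]
  rw [abs_le] at hsum hsub ⊢
  constructor <;> linarith [hsum.1, hsum.2, hsub.1, hsub.2]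

/-- The second moment of the real part of the prime Dirichlet polynomial on the critical line. -/
theorem abs_integral_re_sum_sq_sub_le {y : ℝ} (hy : 0 ≤ y) (T : ℝ) :
    |(∫ t in T..(2 * T),
        ((∑ p ∈ primesUpTo y, (p : ℂ) ^ (-(1 / 2 : ℂ) - t * Complex.I)).re) ^ 2)
      - T / 2 * ∑ p ∈ primesUpTo y, 1 / (p : ℝ)| ≤ 2 * y ^ 3 := by
  set s := primesUpTo y
  set w : ℕ → ℝ := fun p => (p : ℝ) ^ (-(1 / 2) : ℝ) with hw
  have hw0 : ∀ p, 0 ≤ w p := fun p => by positivity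
  have hw1 : ∀ p ∈ s, w p ≤ 1 := fun p hp =>
    Real.rpow_le_one_of_one_le_of_nonpos
      (by exact_mod_cast (mem_primesUpTo hp).1.one_le) (by norm_num)
  have hexpand : (∫ t in T..(2 * T),
      ((∑ p ∈ s, (p : ℂ) ^ (-(1 / 2 : ℂ) - t * Complex.I)).re) ^ 2)
      = ∑ p ∈ s, ∑ q ∈ s, w p * w q *
          ∫ t in T..(2 * T), Real.cos (Real.log p * t) * Real.cos (Real.log q * t) := by
    simp only [← intervalIntegral.integral_const_mul]
    have hintegrable : ∀ p q : ℕ, IntervalIntegrable (fun t => w p * w q *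
        (Real.cos (Real.log p * t) * Real.cos (Real.log q * t))) volume T (2 * T) :=
      fun p q => (by fun_prop : Continuous _).intervalIntegrable _ _
    rw [Finset.sum_congr rfl fun p _ =>
      (intervalIntegral.integral_finsetSum fun q _ => hintegrable p q).symm]
    rw [← intervalIntegral.integral_finsetSum fun p _ =>
      (by fun_prop : Continuous _).intervalIntegrable _ _]
    refine intervalIntegral.integral_congr fun t _ => ?_
    rw [Complex.re_sum, Finset.sum_congr rfl fun p hp =>
      re_natCast_cpow_neg_half_sub (mem_primesUpTo hp).1.pos t, sq, Finset.sum_mul_sum]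
    exact Finset.sum_congr rfl fun p _ => Finset.sum_congr rfl fun q _ => by ring
  have hdiag : T / 2 * ∑ p ∈ s, 1 / (p : ℝ)
      = ∑ p ∈ s, ∑ q ∈ s, w p * w q * (if p = q then T / 2 else 0) := by
    rw [Finset.mul_sum]
    refine Finset.sum_congr rfl fun p hp => ?_
    have hp0 : (0 : ℝ) < p := by exact_mod_cast (mem_primesUpTo hp).1.pos
    simp only [mul_ite, mul_zero, Finset.sum_ite_eq, if_pos hp, hw]
    rw [← Real.rpow_add hp0, show (-(1 / 2) + -(1 / 2) : ℝ) = -1 by norm_num, Real.rpow_neg_one]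
    ring
  rw [hexpand, hdiag]
  simp only [← Finset.sum_sub_distrib, ← mul_sub]
  have hcard := card_primesUpTo_le hy
  calc _ ≤ ∑ p ∈ s, ∑ q ∈ s, 2 * y := by
        refine (Finset.abs_sum_le_sum_abs _ _).trans (Finset.sum_le_sum fun p hp => ?_)
        refine (Finset.abs_sum_le_sum_abs _ _).trans (Finset.sum_le_sum fun q hq => ?_)
        obtain ⟨hp1, hp2⟩ := mem_primesUpTo hp
        obtain ⟨hq1, hq2⟩ := mem_primesUpTo hq
        rw [abs_mul, abs_of_nonneg (mul_nonneg (hw0 p) (hw0 q))]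
        exact (mul_le_of_le_one_left (abs_nonneg _)
          (mul_le_one₀ (hw1 p hp) (hw0 q) (hw1 q hq))).trans
          (abs_integral_cos_log_mul_cos_log_sub_le hp1 hq1 hp2 hq2)
    _ = 2 * y * ((s.card : ℝ) * s.card) := by
        simp only [Finset.sum_const, nsmul_eq_mul]
        ring
    _ ≤ 2 * y * (y * y) := by gcongr
    _ = 2 * y ^ 3 := by ring

theorem stmt_10 :
    ∃ C : ℝ, 0 < C ∧
      ∀ T : ℝ, 3 ≤ T →
        |(1 / T) * (∫ t in T..(2 * T),
              ((∑ p ∈ primesUpTo (Real.exp (Real.sqrt (Real.log T))),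
                  (p : ℂ) ^ (-(1 / 2 : ℂ) - t * Complex.I)).re) ^ 2)
            - (1 / 4) * Real.log (Real.log T)| ≤ C := by
  obtain ⟨C, hC0, hC⟩ := exists_abs_sum_one_div_sub_log_log_le
  refine ⟨2 * Real.exp (9 / 4) + C / 2, by positivity, fun T hT => ?_⟩
  have hT0 : 0 < T := by linarith
  have hL1 : 1 ≤ Real.log T := by
    rw [Real.le_log_iff_exp_le hT0]
    linarith [Real.exp_one_lt_d9]
  set r := Real.sqrt (Real.log T) with hr
  have hr1 : 1 ≤ r := Real.one_le_sqrt.2 hL1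
  have hrsq : r ^ 2 = Real.log T := Real.sq_sqrt (by linarith)
  have hy2 : 2 ≤ Real.exp r := by linarith [Real.add_one_le_exp r]
  have hmertens := hC _ hy2
  have hmoment := abs_integral_re_sum_sq_sub_le (Real.exp_pos r).le T
  have hcube : Real.exp r ^ 3 ≤ Real.exp (9 / 4) * T := by
    rw [← Real.exp_nat_mul]
    conv_rhs => rw [← Real.exp_log hT0, ← Real.exp_add, ← hrsq]
    refine Real.exp_le_exp.2 ?_
    push_cast
    nlinarith [sq_nonneg (r - 3 / 2)]
  rw [Real.log_exp, hr, Real.log_sqrt (by linarith), ← hr] at hmertens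
  set S := ∑ p ∈ primesUpTo (Real.exp r), 1 / (p : ℝ)
  set J := ∫ t in T..(2 * T), ((∑ p ∈ primesUpTo (Real.exp r),
    (p : ℂ) ^ (-(1 / 2 : ℂ) - t * Complex.I)).re) ^ 2
  have hJ : |1 / T * J - S / 2| ≤ 2 * Real.exp (9 / 4) := by
    rw [show 1 / T * J - S / 2 = (J - T / 2 * S) / T by field_simp, abs_div, abs_of_pos hT0,
      div_le_iff₀ hT0]
    linarith
  rw [abs_le] at hJ hmertens ⊢
  constructor <;> linarith [hJ.1, hJ.2, hmertens.1, hmertens.2]
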